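/- arXiv:1207.6127 — 2 statements merged into one kernel-verified Lean document; each statement's English description precedes it below -/
import Mathlib

section
/- For any tree T of order at least 2, the path cover number of T is at most one less than its number of end-vertices: P(T) ≤ σ(T) − 1. -/
open SimpleGraph

variable {V : Type*}

/-- `W` is a resolving set of `G`: every pair of distinct vertices is resolved
by some vertex of `W` via graph distance. -/
def IsResolvingSet (G : SimpleGraph V) (W : Set V) : Prop :=
  ∀ u v : V, u ≠ v → ∃ w ∈ W, G.dist u w ≠ G.dist v w

/-- The metric dimension of `G`: minimum cardinality of a resolving set. -/
noncomputable def metricDim (G : SimpleGraph V) : ℕ :=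
  sInf {k | ∃ W : Set V, W.ncard = k ∧ IsResolvingSet G W}

/-- One global application of the zero-forcing color-change rule:
a black vertex `u` forces its unique white neighbor to become black. -/
def zfStep (G : SimpleGraph V) (S : Set V) : Set V :=
  S ∪ {v | ∃ u ∈ S, G.Adj u v ∧ ∀ w, G.Adj u w → w ∉ S → w = v}

/-- `S` is a zero forcing set of `G` if iterating the color-change rule
starting from `S` eventually turns all vertices black. -/
def IsZeroForcingSet (G : SimpleGraph V) (S : Set V) : Prop :=
  ∃ m : ℕ, (zfStep G)^[m] S = Set.univ

/-- The zero forcing number of `G`: minimum cardinality of a zero forcing set. -/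
noncomputable def zeroForcingNum (G : SimpleGraph V) : ℕ :=
  sInf {k | ∃ S : Set V, S.ncard = k ∧ IsZeroForcingSet G S}

/-- The wheel graph `W_{1,n} = C_n + K_1`: hub `none` joined to the cycle `C_n`
on vertices `some i`, `i : Fin n`. -/
def wheelGraph (n : ℕ) : SimpleGraph (Option (Fin n)) :=
  SimpleGraph.fromRel (fun u v =>
    match u, v with
    | none, some _ => True
    | some i, some j => ((i : ℕ) : ZMod n) + 1 = ((j : ℕ) : ZMod n)
    | _, _ => False)

/-- The bouquet of `n` circles of lengths `k 0 + 1, …, k (n-1) + 1`: the cut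
vertex is `none`; the `i`-th circle consists of `none` together with the vertices
`some ⟨i, j⟩`, `j : Fin (k i)`, in cyclic order. -/
def bouquet (n : ℕ) (k : Fin n → ℕ) : SimpleGraph (Option (Σ i : Fin n, Fin (k i))) :=
  SimpleGraph.fromRel (fun u v =>
    match u, v with
    | none, some a => (a.2 : ℕ) = 0 ∨ (a.2 : ℕ) = k a.1 - 1
    | some a, some b => a.1 = b.1 ∧ ((b.2 : ℕ) = (a.2 : ℕ) + 1)
    | _, _ => False)

/-- The path cover number of `G`: the minimum number of vertex-disjoint induced
paths covering all the vertices of `G`. -/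
noncomputable def pathCoverNum (G : SimpleGraph V) : ℕ :=
  sInf {m | ∃ f : V → Fin m, ∀ i : Fin m,
    ∃ k, 1 ≤ k ∧ Nonempty ((G.induce (f ⁻¹' {i})) ≃g SimpleGraph.pathGraph k)}

/-- `G` contains a Hamiltonian path. -/
def HasHamiltonianPath [DecidableEq V] (G : SimpleGraph V) : Prop :=
  ∃ (u v : V) (p : G.Walk u v), p.IsHamiltonian

/-- `S` is the vertex set of an induced path of `G`. -/
def IsPathSet {V : Type*} (G : SimpleGraph V) (S : Set V) : Prop :=
  ∃ k, 1 ≤ k ∧ ∃ e : pathGraph k ↪g G, Set.range e = S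

theorem IsPathSet.iso {V : Type*} {G : SimpleGraph V} {S : Set V} (h : IsPathSet G S) :
    ∃ k, 1 ≤ k ∧ Nonempty ((G.induce S) ≃g SimpleGraph.pathGraph k) := by
  obtain ⟨k, hk, e, rfl⟩ := h
  refine ⟨k, hk, ⟨RelIso.symm ⟨Equiv.ofInjective e e.injective, ?_⟩⟩⟩
  intro a b
  simp

theorem IsPathSet.map {V W : Type*} {G : SimpleGraph V} {H : SimpleGraph W} (g : G ↪g H)
    {S : Set V} (h : IsPathSet G S) : IsPathSet H (g '' S) := by
  obtain ⟨k, hk, e, rfl⟩ := h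
  refine ⟨k, hk, g.comp e, ?_⟩
  ext x
  simp

theorem isPathSet_singleton {V : Type*} (G : SimpleGraph V) (v : V) : IsPathSet G {v} := by
  refine ⟨1, le_rfl, ⟨⟨fun _ => v, fun a b _ => Subsingleton.elim a b⟩, ?_⟩, ?_⟩
  · intro a b
    have : a = b := Subsingleton.elim a b
    subst this
    simp
  · exact Set.range_const

theorem IsPathSet.cons {V : Type*} {G : SimpleGraph V} {k : ℕ} (e : pathGraph (k + 1) ↪g G)
    {v : V} (hv : v ∉ Set.range e) (hadj : G.Adj v (e 0))
    (huniq : ∀ i, G.Adj v (e i) → i = 0) : IsPathSet G (insert v (Set.range e)) := by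
  have hadj' : ∀ i, G.Adj v (e i) ↔ i = 0 := fun i => ⟨huniq i, by rintro rfl; exact hadj⟩
  refine ⟨k + 2, by omega, ⟨⟨Fin.cons v e, ?_⟩, ?_⟩, ?_⟩
  · exact Fin.cons_injective_iff.2 ⟨hv, e.injective⟩
  · intro a b
    refine Fin.cases ?_ (fun a => ?_) a <;> refine Fin.cases ?_ (fun b => ?_) b
    · simp
    · change G.Adj v (e b) ↔ _
      rw [hadj', pathGraph_adj, Fin.ext_iff, Fin.val_succ]
      simp only [Fin.val_zero]
      omega
    · change G.Adj (e a) v ↔ _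
      rw [G.adj_comm, hadj', pathGraph_adj, Fin.ext_iff, Fin.val_succ]
      simp only [Fin.val_zero]
      omega
    · simp [pathGraph_adj]
  · exact Fin.range_cons v e

theorem IsPathSet.insert {V : Type*} {G : SimpleGraph V} {S : Set V} (h : IsPathSet G S)
    {u v : V} (hu : u ∈ S) (hv : v ∉ S) (hadj : G.Adj v u)
    (huniq : ∀ w ∈ S, G.Adj v w → w = u)
    (hend : ∀ x ∈ S, ∀ y ∈ S, G.Adj u x → G.Adj u y → x = y) :
    IsPathSet G (insert v S) := by
  obtain ⟨k, hk, e, rfl⟩ := h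
  obtain ⟨k, rfl⟩ : ∃ j, k = j + 1 := ⟨k - 1, by omega⟩
  obtain ⟨i, rfl⟩ := hu
  have hu' : ∀ j, G.Adj v (e j) → j = i := fun j hj => e.injective (huniq _ ⟨j, rfl⟩ hj)
  have hi : (i : ℕ) = 0 ∨ (i : ℕ) = k := by
    by_contra hcon
    push Not at hcon
    have hlt := i.2
    have := hend (e ⟨i - 1, by omega⟩) ⟨_, rfl⟩ (e ⟨i + 1, by omega⟩) ⟨_, rfl⟩
      (e.map_adj_iff.2 (by rw [pathGraph_adj]; simp; omega))
      (e.map_adj_iff.2 (by rw [pathGraph_adj]; simp))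
    have := e.injective this
    rw [Fin.mk.injEq] at this
    omega
  rcases hi with hi | hi
  · obtain rfl : i = 0 := Fin.ext hi
    exact IsPathSet.cons e hv hadj hu'
  · let r : pathGraph (k + 1) ↪g pathGraph (k + 1) := ⟨⟨Fin.rev, Fin.rev_injective⟩, by
      intro a b
      have := a.2
      have := b.2
      simp only [Function.Embedding.coeFn_mk, pathGraph_adj, Fin.val_rev]
      omega⟩
    have hr : ∀ j, r j = Fin.rev j := fun _ => rfl
    obtain rfl : i = Fin.rev 0 := Fin.ext (by simp [hi])
    have hrange : Set.range (e.comp r) = Set.range e := by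
      have : (e.comp r : Fin (k + 1) → V) = e ∘ Fin.rev := rfl
      rw [this]
      exact Fin.rev_surjective.range_comp _
    rw [← hrange] at hv ⊢
    refine IsPathSet.cons (e.comp r) hv hadj ?_
    intro j hj
    exact Fin.rev_injective (hu' _ hj)

theorem exists_cover (n : ℕ) : ∀ {V : Type*} [Finite V] (T : SimpleGraph V), T.IsTree →
    Nat.card V = n + 2 →
    ∃ m, m + 1 ≤ {v : V | ∃! w, T.Adj v w}.ncard ∧
      ∃ f : V → Fin m, ∀ i, IsPathSet T (f ⁻¹' {i}) := by
  classical
  induction n with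
  | zero =>
    intro V _ T hT hc
    have := Fintype.ofFinite V
    have : Nontrivial V := Finite.one_lt_card_iff_nontrivial.1 (by omega)
    obtain ⟨v, hv⟩ := hT.exists_vert_degree_one_of_nontrivial
    obtain ⟨u, huv, hun⟩ := degree_eq_one_iff_existsUnique_adj.1 hv
    obtain ⟨a, b, hab, hall⟩ := Nat.card_eq_two_iff.1 hc
    have hall' : ∀ x, x = v ∨ x = u := by
      have hx : ∀ x, x = a ∨ x = b := fun x => by
        have : x ∈ ({a, b} : Set V) := by rw [hall]; trivial
        simpa using this
      have := huv.ne
      intro x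
      have h1 := hx x
      have h2 := hx u
      have h3 := hx v
      grind
    refine ⟨1, ?_, fun _ => 0, fun i => ?_⟩
    · rw [show {v : V | ∃! w, T.Adj v w} = {v, u} from ?_, Set.ncard_pair huv.ne]
      ext x
      simp only [Set.mem_ofPred_eq, Set.mem_insert_iff, Set.mem_singleton_iff, hall', iff_true]
      rcases hall' x with rfl | rfl
      · exact ⟨u, huv, hun⟩
      · refine ⟨v, huv.symm, fun y hy => (hall' y).resolve_right hy.ne'⟩
    · have := (isPathSet_singleton T u).insert (u := u) (v := v) rfl huv.ne huv (by simp)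
        (by simp +contextual)
      convert this
      ext x
      have := hall' x
      simp [this, Subsingleton.elim i 0]
  | succ n ih =>
    intro V _ T hT hc
    have := Fintype.ofFinite V
    have : Nontrivial V := Finite.one_lt_card_iff_nontrivial.1 (by omega)
    obtain ⟨v, hv⟩ := hT.exists_vert_degree_one_of_nontrivial
    obtain ⟨u, huv, hun⟩ := degree_eq_one_iff_existsUnique_adj.1 hv
    have hT' : (T.induce {v}ᶜ).IsTree :=
      ⟨hT.connected.induce_compl_singleton_of_degree_eq_one hv, hT.isAcyclic.induce _⟩
    have hc' : Nat.card ({v}ᶜ : Set V) = n + 2 := by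
      have := Set.ncard_add_ncard_compl ({v} : Set V)
      rw [Set.ncard_singleton] at this
      rw [Nat.card_coe_set_eq]
      omega
    obtain ⟨m, hm, f, hf⟩ := ih (T.induce {v}ᶜ) hT' hc'
    have huv' : u ∈ ({v}ᶜ : Set V) := huv.ne'
    let ι : T.induce ({v}ᶜ : Set V) ↪g T := Embedding.induce _
    set L := {v : V | ∃! w, T.Adj v w} with hL
    set L' := {x : ({v}ᶜ : Set V) | ∃! w, (T.induce {v}ᶜ).Adj x w} with hL'
    have hvL : v ∈ L := ⟨u, huv, hun⟩
    have hLL : ∀ x ∈ L', (x : V) ≠ u → (x : V) ∈ L := by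
      rintro ⟨x, hxv⟩ ⟨⟨w, hw⟩, hxw, hw'⟩ hxu
      refine ⟨w, hxw, fun y hy => ?_⟩
      by_cases hyv : y = v
      · subst hyv
        exact absurd (hun x hy.symm) hxu
      · exact congrArg Subtype.val (hw' ⟨y, hyv⟩ hy)
    have hinj : (Subtype.val '' L').ncard = L'.ncard :=
      Set.ncard_image_of_injective _ Subtype.val_injective
    by_cases hu : (⟨u, huv'⟩ : ({v}ᶜ : Set V)) ∈ L'
    · refine ⟨m, ?_, fun x => if h : x = v then f ⟨u, huv'⟩ else f ⟨x, h⟩, fun i => ?_⟩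
      · have h1 : insert v (Subtype.val '' L' \ {u}) ⊆ L := by
          intro x hx
          rcases hx with rfl | ⟨⟨x, hx, rfl⟩, hxu⟩
          · exact hvL
          · exact hLL x hx hxu
        have h2 := Set.ncard_le_ncard h1 (Set.toFinite _)
        rw [Set.ncard_insert_of_notMem (by rintro ⟨⟨x, hx, hxv⟩, -⟩; exact x.2 hxv)] at h2
        have h3 := Set.ncard_sdiff_singleton_add_one (s := Subtype.val '' L') (a := u) ⟨_, hu, rfl⟩
        omega
      · have h1 := (hf i).map ι
        by_cases hi : f ⟨u, huv'⟩ = i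
        · have h2 := h1.insert (u := u) (v := v) ⟨⟨u, huv'⟩, hi, rfl⟩
            (by rintro ⟨x, hx, hxv⟩; exact x.2 hxv) huv (fun w _ hw => hun w hw) ?_
          · convert h2 using 1
            ext x
            by_cases hx : x = v
            · simp [hx, hi]
            · simp [hx, ι]
          · rintro _ ⟨x, -, rfl⟩ _ ⟨y, -, rfl⟩ hx hy
            exact congrArg _ (hu.unique (y₁ := x) (y₂ := y) hx hy)
        · convert h1 using 1
          ext x
          by_cases hx : x = v
          · simp [hx, hi, ι]
          · simp [hx, ι]
    · refine ⟨m + 1, ?_, fun x => if h : x = v then Fin.last m else (f ⟨x, h⟩).castSucc,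
        fun i => ?_⟩
      · have h1 : insert v (Subtype.val '' L') ⊆ L := by
          intro x hx
          rcases hx with rfl | ⟨x, hx, rfl⟩
          · exact hvL
          · refine hLL x hx ?_
            rintro rfl
            exact hu hx
        have h2 := Set.ncard_le_ncard h1 (Set.toFinite _)
        rw [Set.ncard_insert_of_notMem (by rintro ⟨x, hx, hxv⟩; exact x.2 hxv)] at h2
        omega
      · refine Fin.lastCases ?_ (fun i => ?_) i
        · convert isPathSet_singleton T v using 1
          ext x
          by_cases hx : x = v
          · simp [hx]
          · simp [hx, (Fin.castSucc_lt_last _).ne]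
        · convert (hf i).map ι using 1
          ext x
          by_cases hx : x = v
          · simp [hx, ι, (Fin.castSucc_lt_last _).ne']
          · simp [hx, ι]

/-- For any tree `T` of order at least 2, the path cover number of `T` is at most
`σ(T) - 1`, where `σ(T)` is the number of end-vertices (degree-one vertices) of `T`. -/
theorem pathCoverNum_le_sigma_sub_one {V : Type*} [Fintype V] [DecidableEq V]
    (T : SimpleGraph V) [DecidableRel T.Adj] (hT : T.IsTree)
    (hn : 2 ≤ Fintype.card V) :
    pathCoverNum T ≤ ({v : V | T.degree v = 1} : Set V).ncard - 1 := by
  obtain ⟨m, hm, f, hf⟩ := exists_cover (Fintype.card V - 2) T hT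
    (by rw [Nat.card_eq_fintype_card]; omega)
  have h : pathCoverNum T ≤ m := Nat.sInf_le ⟨f, fun i => (hf i).iso⟩
  simp only [degree_eq_one_iff_existsUnique_adj]
  omega
end

section
/- Let n ≥ 3 and let G = L(W_{1,n}) be the line graph of the wheel graph W_{1,n}. Then for every edge e of G, the graph G − e obtained by deleting e satisfies Z(G − e) = n. -/
open SimpleGraph

variable {V : Type*}

section ZFGeneral

variable {V W : Type*}

lemma zf_subset_step (G : SimpleGraph V) (S : Set V) : S ⊆ zfStep G S :=
  fun _ hx => Or.inl hx

lemma zf_iter_mono (G : SimpleGraph V) (S : Set V) :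
    Monotone (fun m => (zfStep G)^[m] S) := by
  refine monotone_nat_of_le_succ fun m => ?_
  simp only [Function.iterate_succ_apply']
  exact zf_subset_step G _

lemma zf_of_closed [Finite V] (G : SimpleGraph V) (S : Set V)
    (h : ∀ T : Set V, S ⊆ T →
      (∀ u v, u ∈ T → G.Adj u v → (∀ w, G.Adj u w → w ≠ v → w ∈ T) → v ∈ T) →
      ∀ v, v ∈ T) : IsZeroForcingSet G S := by
  obtain ⟨m, hm⟩ := WellFoundedGT.monotone_chain_condition
    (⟨fun m => (zfStep G)^[m] S, zf_iter_mono G S⟩ : ℕ →o Set V)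
  refine ⟨m, Set.eq_univ_of_forall (h _ (zf_iter_mono G S (Nat.zero_le m)) ?_)⟩
  intro u v hu huv hw
  have h1 : (zfStep G)^[m] S = (zfStep G)^[m+1] S := hm (m+1) (Nat.le_succ m)
  rw [h1, Function.iterate_succ_apply']
  right
  refine ⟨u, hu, huv, fun w huw hwT => ?_⟩
  by_contra hne
  exact hwT (hw w huw hne)

lemma zfStep_iso {G : SimpleGraph V} {G' : SimpleGraph W} (φ : G ≃g G') (S : Set V) :
    zfStep G' (φ '' S) = φ '' zfStep G S := by
  ext y
  obtain ⟨y, rfl⟩ := φ.surjective y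
  simp only [zfStep, Set.mem_union, Set.mem_ofPred_eq, φ.injective.mem_set_image]
  refine or_congr Iff.rfl ?_
  constructor
  · rintro ⟨_, ⟨u, hu, rfl⟩, h1, h2⟩
    refine ⟨u, hu, φ.map_adj_iff.1 h1, fun w hw hwS => φ.injective (h2 _ (φ.map_adj_iff.2 hw) ?_)⟩
    rwa [φ.injective.mem_set_image]
  · rintro ⟨u, hu, h1, h2⟩
    refine ⟨φ u, ⟨u, hu, rfl⟩, φ.map_adj_iff.2 h1, fun w hw hwS => ?_⟩
    obtain ⟨w, rfl⟩ := φ.surjective w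
    rw [φ.injective.mem_set_image] at hwS
    rw [h2 w (φ.map_adj_iff.1 hw) hwS]

lemma isZF_iso {G : SimpleGraph V} {G' : SimpleGraph W} (φ : G ≃g G') {S : Set V}
    (h : IsZeroForcingSet G S) : IsZeroForcingSet G' (φ '' S) := by
  obtain ⟨m, hm⟩ := h
  refine ⟨m, ?_⟩
  have : ∀ k, (zfStep G')^[k] (φ '' S) = φ '' ((zfStep G)^[k] S) := by
    intro k
    induction k with
    | zero => rfl
    | succ k ih => rw [Function.iterate_succ_apply', ih, zfStep_iso, Function.iterate_succ_apply']
  rw [this, hm, Set.image_univ, φ.surjective.range_eq]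

lemma zfNum_iso {G : SimpleGraph V} {G' : SimpleGraph W} (φ : G ≃g G') :
    zeroForcingNum G = zeroForcingNum G' := by
  unfold zeroForcingNum
  congr 1
  ext k
  constructor
  · rintro ⟨S, hS, hz⟩
    exact ⟨φ '' S, by rw [Set.ncard_image_of_injective _ φ.injective, hS], isZF_iso φ hz⟩
  · rintro ⟨S, hS, hz⟩
    exact ⟨φ.symm '' S, by rw [Set.ncard_image_of_injective _ φ.symm.injective, hS],
      isZF_iso φ.symm hz⟩

end ZFGeneral

section Model

/-- Concrete model of `L(W_{1,n})`: `inl i` is the `i`-th spoke, `inr i` the rim edge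
from `i` to `i+1`. -/
def lwAdj (n : ℕ) : ZMod n ⊕ ZMod n → ZMod n ⊕ ZMod n → Prop
  | .inl i, .inl j => i ≠ j
  | .inl i, .inr j => j = i ∨ j + 1 = i
  | .inr j, .inl i => j = i ∨ j + 1 = i
  | .inr i, .inr j => i ≠ j ∧ (j = i + 1 ∨ i = j + 1)

def lw (n : ℕ) : SimpleGraph (ZMod n ⊕ ZMod n) where
  Adj := lwAdj n
  symm := ⟨by
    rintro (i | i) (j | j) h
    · exact Ne.symm h
    · exact h
    · exact h
    · exact ⟨h.1.symm, h.2.symm⟩⟩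
  loopless := ⟨by
    rintro (i | i) h
    · exact h rfl
    · exact h.1 rfl⟩

variable {n : ℕ}

@[simp] lemma lw_ll (i j : ZMod n) : (lw n).Adj (.inl i) (.inl j) ↔ i ≠ j := Iff.rfl
@[simp] lemma lw_lr (i j : ZMod n) : (lw n).Adj (.inl i) (.inr j) ↔ j = i ∨ j + 1 = i := Iff.rfl
@[simp] lemma lw_rl (i j : ZMod n) : (lw n).Adj (.inr j) (.inl i) ↔ j = i ∨ j + 1 = i := Iff.rfl
@[simp] lemma lw_rr (i j : ZMod n) :
  (lw n).Adj (.inr i) (.inr j) ↔ i ≠ j ∧ (j = i + 1 ∨ i = j + 1) := Iff.rfl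

lemma zmod_facts (hn : 3 ≤ n) : (1 : ZMod n) ≠ 0 ∧ (2 : ZMod n) ≠ 0 := by
  constructor
  · have := (ZMod.natCast_eq_zero_iff 1 n).not.2 (fun h => by have := Nat.le_of_dvd one_pos h; omega)
    simpa using this
  · have := (ZMod.natCast_eq_zero_iff 2 n).not.2 (fun h => by have := Nat.le_of_dvd two_pos h; omega)
    simpa using this

/-- The linear conditions defining the kernel vectors. -/
def KerCond (n : ℕ) [NeZero n] (x : ZMod n ⊕ ZMod n → ℝ) : Prop :=
  ∀ k : ZMod n, n * x (.inl k) + x (.inr k) - x (.inr (k - 1)) = ∑ j, x (.inl j)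

lemma ker_force [NeZero n] (hn : 3 ≤ n) {x : ZMod n ⊕ ZMod n → ℝ} (hx : KerCond n x)
    (u v : ZMod n ⊕ ZMod n) (hu : x u = 0) (huv : (lw n).Adj u v)
    (h : ∀ w, (lw n).Adj u w → w ≠ v → x w = 0) : x v = 0 := by
  obtain ⟨h1, h2⟩ := zmod_facts hn
  have hn0 : (n : ℝ) ≠ 0 := by exact_mod_cast (by omega : n ≠ 0)
  rcases u with i | i
  · have hi := hx i
    have hpi : i - 1 ≠ i := by intro h; apply h1; linear_combination -h
    rcases v with j | j
    · rw [Finset.sum_eq_single j] at hi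
      · have e1 := h (.inr i) (by simp) (by simp)
        have e2 := h (.inr (i-1)) (by simp) (by simp)
        rw [hu, e1, e2] at hi
        linarith
      · intro b _ hb
        by_cases hbi : b = i
        · rw [hbi, hu]
        · exact h _ (by simpa using Ne.symm hbi) (by simpa using hb)
      · simp
    · rw [Finset.sum_eq_zero] at hi
      · have hj : j = i ∨ j = i - 1 := by
          rcases huv with h | h
          · exact Or.inl h
          · right; rw [← h]; ring
        rcases hj with rfl | rfl
        · have e2 := h (.inr (j-1)) (by simp) (by simpa using hpi)
          rw [hu, e2] at hi
          linarith
        · have e2 := h (.inr i) (by simp) (by simpa using hpi.symm)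
          rw [hu, e2] at hi
          linarith
      · intro b _
        by_cases hbi : b = i
        · rw [hbi, hu]
        · exact h _ (by simpa using Ne.symm hbi) (by simp)
  · have hi := (hx i).trans (hx (i+1)).symm
    have a1 : i - 1 ≠ i := by intro h; apply h1; linear_combination -h
    have a2 : i + 1 ≠ i := by intro h; apply h1; linear_combination h
    have a3 : i - 1 ≠ i + 1 := by intro h; apply h2; linear_combination -h
    rw [add_sub_cancel_right, hu] at hi
    have c1 := h (.inl i) (by simp)
    have c2 := h (.inl (i+1)) (by simp)
    have c3 := h (.inr (i+1)) (by simpa using h1)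
    have c4 := h (.inr (i-1)) (by simp [a1.symm])
    rcases v with j | j
    · rcases huv with rfl | rfl
      · rw [c2 (by simpa using h1), c3 (by simp), c4 (by simp)] at hi
        have : (n : ℝ) * x (.inl i) = 0 := by linarith
        exact (mul_eq_zero.1 this).resolve_left hn0
      · rw [c1 (by simpa using h1), c3 (by simp), c4 (by simp)] at hi
        have : (n : ℝ) * x (.inl (i+1)) = 0 := by linarith
        exact (mul_eq_zero.1 this).resolve_left hn0
    · have hj : j = i + 1 ∨ j = i - 1 := by
        rcases huv.2 with h | h
        · exact Or.inl h
        · right; rw [h]; ring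
      rcases hj with rfl | rfl
      · rw [c1 (by simp), c2 (by simp), c4 (by simpa using a3)] at hi
        linarith
      · rw [c1 (by simp), c2 (by simp), c3 (by simpa using a3.symm)] at hi
        linarith

lemma ker_exists [NeZero n] (S : Set (ZMod n ⊕ ZMod n)) (hS : S.ncard ≤ n) :
    ∃ x : ZMod n ⊕ ZMod n → ℝ, x ≠ 0 ∧ KerCond n x ∧ ∀ v ∈ S, x v = 0 := by
  classical
  let D : ZMod n → ((ZMod n ⊕ ZMod n → ℝ) →ₗ[ℝ] ℝ) := fun k =>
    (n : ℝ) • LinearMap.proj (.inl k) + LinearMap.proj (.inr k) - LinearMap.proj (.inr (k - 1))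
      - ∑ j, LinearMap.proj (.inl j)
  have hD : ∀ k x, D k x = n * x (.inl k) + x (.inr k) - x (.inr (k - 1)) - ∑ j, x (.inl j) := by
    intro k x
    simp [D, LinearMap.sum_apply]
  let L : (ZMod n ⊕ ZMod n → ℝ) →ₗ[ℝ] (S → ℝ) × ({k : ZMod n // k ≠ 0} → ℝ) :=
    LinearMap.prod (LinearMap.pi fun v => LinearMap.proj v.1) (LinearMap.pi fun k => D k.1)
  have hpos : 0 < n := NeZero.pos n
  have hlt : Module.finrank ℝ ((S → ℝ) × ({k : ZMod n // k ≠ 0} → ℝ)) <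
      Module.finrank ℝ (ZMod n ⊕ ZMod n → ℝ) := by
    have h1 : Fintype.card S ≤ n := by
      rw [← Nat.card_eq_fintype_card]; exact hS
    have h2 : Fintype.card {k : ZMod n // k ≠ 0} = n - 1 := by
      rw [Fintype.card_subtype_compl]; simp [ZMod.card]
    simp only [Module.finrank_prod, Module.finrank_fintype_fun_eq_card, Fintype.card_sum, ZMod.card, h2]
    omega
  obtain ⟨x, hx, hx0⟩ := (Submodule.ne_bot_iff _).1 (LinearMap.ker_ne_bot_of_finrank_lt (f := L) hlt)
  · rw [LinearMap.mem_ker] at hx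
    have hxS := congrArg Prod.fst hx
    have hxD := congrArg Prod.snd hx
    refine ⟨x, hx0, ?_, fun v hv => congrFun hxS ⟨v, hv⟩⟩
    have hk : ∀ k : ZMod n, k ≠ 0 → D k x = 0 := fun k hk => congrFun hxD ⟨k, hk⟩
    have hsum : ∑ k, D k x = 0 := by
      simp only [hD, Finset.sum_sub_distrib, Finset.sum_add_distrib, ← Finset.mul_sum]
      have : ∑ k : ZMod n, x (.inr (k - 1)) = ∑ k : ZMod n, x (.inr k) :=
        (Equiv.subRight (1 : ZMod n)).sum_comp (fun k => x (.inr k))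
      rw [this]
      simp [ZMod.card]
    rw [Finset.sum_eq_single 0 (fun b _ hb => hk b hb) (by simp)] at hsum
    intro k
    have : D k x = 0 := by
      by_cases h : k = 0
      · rw [h, hsum]
      · exact hk k h
    rw [hD] at this
    linarith

lemma lower_aux [NeZero n] (hn : 3 ≤ n) (a b : ZMod n ⊕ ZMod n) (S : Set (ZMod n ⊕ ZMod n))
    (hz : IsZeroForcingSet ((lw n).deleteEdges {s(a, b)}) S)
    (hab : ∀ m, b ∈ (zfStep ((lw n).deleteEdges {s(a, b)}))^[m] S →
      a ∈ (zfStep ((lw n).deleteEdges {s(a, b)}))^[m] S) : n ≤ S.ncard := by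
  by_contra hlt
  obtain ⟨x, hx0, hx, hxS⟩ := ker_exists (insert b S)
    ((Set.ncard_insert_le b S).trans (by omega))
  have key : ∀ m, ∀ v ∈ (zfStep ((lw n).deleteEdges {s(a, b)}))^[m] S, x v = 0 := by
    intro m
    induction m with
    | zero => exact fun v hv => hxS v (Or.inr hv)
    | succ m ih =>
      intro v hv
      rw [Function.iterate_succ_apply'] at hv
      rcases hv with hv | ⟨u, hu, huv, hw⟩
      · exact ih v hv
      · rw [deleteEdges_adj] at huv
        refine ker_force hn hx u v (ih u hu) huv.1 fun w huw hwv => ?_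
        by_cases he : s(u, w) = s(a, b)
        · rw [Sym2.eq_iff] at he
          rcases he with ⟨rfl, rfl⟩ | ⟨rfl, rfl⟩
          · exact hxS _ (Or.inl rfl)
          · exact ih _ (hab m hu)
        · by_contra hne
          refine hwv (hw w (by rw [deleteEdges_adj]; exact ⟨huw, he⟩) fun hwT => hne (ih w hwT))
  obtain ⟨m, hm⟩ := hz
  exact hx0 (funext fun v => key m v (hm ▸ Set.mem_univ v))

lemma lower [NeZero n] (hn : 3 ≤ n) (a b : ZMod n ⊕ ZMod n) (S : Set (ZMod n ⊕ ZMod n))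
    (hz : IsZeroForcingSet ((lw n).deleteEdges {s(a, b)}) S) : n ≤ S.ncard := by
  by_cases h : ∀ m, b ∈ (zfStep ((lw n).deleteEdges {s(a, b)}))^[m] S →
      a ∈ (zfStep ((lw n).deleteEdges {s(a, b)}))^[m] S
  · exact lower_aux hn a b S hz h
  · push Not at h
    obtain ⟨m, hb, ha⟩ := h
    have e : s(a, b) = s(b, a) := Sym2.eq_swap
    rw [e] at hz hb ha
    refine lower_aux hn b a S hz fun k hk => ?_
    rcases le_total k m with hkm | hkm
    · exact absurd (zf_iter_mono _ S hkm hk) ha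
    · exact zf_iter_mono _ S hkm hb


/-- Closedness under the colour change rule. -/
def ZFClosed {V : Type*} (G : SimpleGraph V) (T : Set V) : Prop :=
  ∀ u v, u ∈ T → G.Adj u v → (∀ w, G.Adj u w → w ≠ v → w ∈ T) → v ∈ T

lemma zmod_ind_down [NeZero n] {P : ZMod n → Prop} (k : ZMod n) (h0 : P k)
    (h : ∀ i, P i → P (i - 1)) (i : ZMod n) : P i := by
  have : ∀ m : ℕ, P (k - m) := by
    intro m
    induction m with
    | zero => simpa using h0
    | succ m ih =>
      have := h _ ih
      rwa [sub_sub, ← Nat.cast_succ] at this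
  have := this (k - i).val
  rwa [ZMod.natCast_zmod_val, sub_sub_cancel] at this

lemma zmod_ind_up [NeZero n] {P : ZMod n → Prop} (k : ZMod n) (h0 : P k)
    (h : ∀ i, P i → P (i + 1)) (i : ZMod n) : P i := by
  have := zmod_ind_down (P := fun i => P (-i)) (-k) (by simpa using h0)
    (fun i hi => by have := h _ hi; rwa [neg_sub, sub_eq_neg_add]) (-i)
  simpa using this

lemma fin_down [NeZero n] {a b : ZMod n ⊕ ZMod n} {T : Set (ZMod n ⊕ ZMod n)}
    (hT : ZFClosed ((lw n).deleteEdges {s(a, b)}) T)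
    (hs : ∀ i, .inl i ∈ T) (k : ZMod n) (hk : .inr k ∈ T)
    (he : ∀ i : ZMod n, s(.inl i, .inr (i - 1)) ≠ s(a, b)) (v : ZMod n ⊕ ZMod n) : v ∈ T := by
  rcases v with i | i
  · exact hs i
  refine zmod_ind_down (P := fun i => .inr i ∈ T) k hk (fun i hi => ?_) i
  refine hT (.inl i) (.inr (i - 1)) (hs i) ?_ ?_
  · rw [deleteEdges_adj]
    exact ⟨by simp, he i⟩
  · rintro (j | j) hw hne
    · exact hs j
    · rw [deleteEdges_adj] at hw
      rcases hw.1 with rfl | h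
      · exact hi
      · exact absurd (by rw [← h]; simp) hne

lemma fin_up [NeZero n] {a b : ZMod n ⊕ ZMod n} {T : Set (ZMod n ⊕ ZMod n)}
    (hT : ZFClosed ((lw n).deleteEdges {s(a, b)}) T)
    (hs : ∀ i, .inl i ∈ T) (k : ZMod n) (hk : .inr k ∈ T)
    (he : ∀ i : ZMod n, s(.inl i, .inr i) ≠ s(a, b)) (v : ZMod n ⊕ ZMod n) : v ∈ T := by
  rcases v with i | i
  · exact hs i
  refine zmod_ind_up (P := fun i => .inr i ∈ T) k hk (fun i hi => ?_) i
  refine hT (.inl (i + 1)) (.inr (i + 1)) (hs _) ?_ ?_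
  · rw [deleteEdges_adj]
    exact ⟨by simp, he _⟩
  · rintro (j | j) hw hne
    · exact hs j
    · rw [deleteEdges_adj] at hw
      rcases hw.1 with rfl | h
      · exact absurd rfl hne
      · rw [add_left_inj] at h
        rwa [h]

/-- All the spokes. -/
def spokes (n : ℕ) : Set (ZMod n ⊕ ZMod n) := Set.range Sum.inl

/-- All spokes but `j`, with the rim edge `i`. -/
def spokes' (n : ℕ) (i j : ZMod n) : Set (ZMod n ⊕ ZMod n) := insert (.inr i) (Sum.inl '' {j}ᶜ)

lemma spokes_card [NeZero n] : (spokes n).ncard = n := by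
  rw [spokes, ← Set.image_univ, Set.ncard_image_of_injective _ Sum.inl_injective, Set.ncard_univ,
    Nat.card_zmod]

lemma spokes'_card [NeZero n] (i j : ZMod n) : (spokes' n i j).ncard = n := by
  rw [spokes', Set.ncard_insert_of_notMem (by simp),
    Set.ncard_image_of_injective _ Sum.inl_injective, Set.ncard_compl, Set.ncard_singleton,
    Nat.card_zmod]
  have := NeZero.pos n
  omega

lemma upper_lr_same [NeZero n] (hn : 3 ≤ n) (i : ZMod n) :
    IsZeroForcingSet ((lw n).deleteEdges {s(.inl i, .inr i)}) (spokes n) := by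
  obtain ⟨h1, h2⟩ := zmod_facts hn
  refine zf_of_closed _ _ fun T hST hT => ?_
  have hs : ∀ j, .inl j ∈ T := fun j => hST ⟨j, rfl⟩
  refine fin_down hT hs (i - 1) ?_ ?_
  · refine hT (.inl i) _ (hs i) ?_ ?_
    · simp [deleteEdges_adj, h1]
    · rintro (j | j) hw hne
      · exact hs j
      · simp only [deleteEdges_adj, lw_lr, Set.mem_singleton_iff] at hw
        rcases hw.1 with rfl | h
        · exact absurd rfl hw.2
        · exact absurd (by rw [← h]; simp) hne
  · intro k h
    simp only [Sym2.eq_iff, Sum.inl.injEq, Sum.inr.injEq, reduceCtorEq, and_self, or_false] at h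
    obtain ⟨rfl, h⟩ := h
    exact h1 (by linear_combination -h)

lemma upper_lr_prev [NeZero n] (hn : 3 ≤ n) (i : ZMod n) :
    IsZeroForcingSet ((lw n).deleteEdges {s(.inl (i + 1), .inr i)}) (spokes n) := by
  obtain ⟨h1, h2⟩ := zmod_facts hn
  refine zf_of_closed _ _ fun T hST hT => ?_
  have hs : ∀ j, .inl j ∈ T := fun j => hST ⟨j, rfl⟩
  refine fin_up hT hs (i + 1) ?_ ?_
  · refine hT (.inl (i + 1)) _ (hs _) ?_ ?_
    · simp [deleteEdges_adj, h1]
    · rintro (j | j) hw hne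
      · exact hs j
      · simp only [deleteEdges_adj, lw_lr, Set.mem_singleton_iff] at hw
        rcases hw.1 with rfl | h
        · exact absurd rfl hne
        · rw [add_left_inj] at h
          exact absurd (by rw [h]) hw.2
  · intro k h
    simp only [Sym2.eq_iff, Sum.inl.injEq, Sum.inr.injEq, reduceCtorEq, and_self, or_false] at h
    obtain ⟨rfl, h⟩ := h
    exact h1 (by linear_combination h)

lemma upper_rr [NeZero n] (hn : 3 ≤ n) (i : ZMod n) :
    IsZeroForcingSet ((lw n).deleteEdges {s(.inr i, .inr (i + 1))}) (spokes' n i (i - 1)) := by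
  obtain ⟨h1, h2⟩ := zmod_facts hn
  have a1 : i ≠ i - 1 := by intro h; apply h1; linear_combination h
  have a3 : i + 1 ≠ i - 1 := by intro h; apply h2; linear_combination h
  refine zf_of_closed _ _ fun T hST hT => ?_
  have hs : ∀ j, j ≠ i - 1 → .inl j ∈ T := fun j hj => hST (Or.inr ⟨j, hj, rfl⟩)
  have hr : .inr i ∈ T := hST (Or.inl rfl)
  have hr' : .inr (i - 1) ∈ T := by
    refine hT (.inr i) _ hr ?_ ?_
    · simp [deleteEdges_adj, a1, a3.symm, h1]
    · rintro (j | j) hw hne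
      · simp only [deleteEdges_adj, lw_rl] at hw
        rcases hw.1 with rfl | rfl
        · exact hs _ a1
        · exact hs _ a3
      · simp only [deleteEdges_adj, lw_rr, Set.mem_singleton_iff] at hw
        rcases hw.1.2 with rfl | h
        · exact absurd rfl hw.2
        · exact absurd (by rw [h]; simp) hne
  have hl : .inl (i - 1) ∈ T := by
    refine hT (.inl i) _ (hs i a1) ?_ ?_
    · simp [deleteEdges_adj, a1]
    · rintro (j | j) hw hne
      · exact hs _ (by simpa using hne)
      · simp only [deleteEdges_adj, lw_lr] at hw
        rcases hw.1 with rfl | h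
        · exact hr
        · rw [← eq_sub_iff_add_eq] at h
          rwa [h]
  refine fin_down hT (fun j => ?_) i hr ?_
  · by_cases h : j = i - 1
    · rwa [h]
    · exact hs j h
  · simp

lemma upper_ll [NeZero n] (hn : 3 ≤ n) (i j : ZMod n) (hij : i ≠ j) :
    IsZeroForcingSet ((lw n).deleteEdges {s(.inl i, .inl j)}) (spokes' n i j) := by
  obtain ⟨h1, h2⟩ := zmod_facts hn
  have a1 : i - 1 ≠ i := by intro h; apply h1; linear_combination -h
  have a2 : i + 1 ≠ i := by intro h; apply h1; linear_combination h
  have a3 : i + 1 ≠ i - 1 := by intro h; apply h2; linear_combination h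
  refine zf_of_closed _ _ fun T hST hT => ?_
  have hs : ∀ k, k ≠ j → .inl k ∈ T := fun k hk => hST (Or.inr ⟨k, hk, rfl⟩)
  have hr : .inr i ∈ T := hST (Or.inl rfl)
  have hr' : .inr (i - 1) ∈ T := by
    refine hT (.inl i) _ (hs i hij) ?_ ?_
    · simp [deleteEdges_adj]
    · rintro (k | k) hw hne
      · simp only [deleteEdges_adj, Set.mem_singleton_iff] at hw
        refine hs _ ?_
        rintro rfl
        exact hw.2 rfl
      · simp only [deleteEdges_adj, lw_lr] at hw
        rcases hw.1 with rfl | h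
        · exact hr
        · exact absurd (by rw [← h]; simp) hne
  have hl : .inl j ∈ T := by
    by_cases hj : j = i + 1
    · have hji : i - 1 ≠ j := by rw [hj]; exact a3.symm
      have hr2 : .inr (i - 1 - 1) ∈ T := by
        refine hT (.inr (i - 1)) _ hr' ?_ ?_
        · simp [deleteEdges_adj, a1.symm]
        · rintro (k | k) hw hne
          · simp only [deleteEdges_adj, lw_rl, sub_add_cancel] at hw
            rcases hw.1 with rfl | rfl
            · exact hs _ hji
            · exact hs _ hij
          · simp only [deleteEdges_adj, lw_rr, sub_add_cancel] at hw
            rcases hw.1.2 with rfl | h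
            · exact hr
            · exact absurd (by rw [h]; simp) hne
      refine hT (.inl (i - 1)) _ (hs _ hji) ?_ ?_
      · simp [deleteEdges_adj, hji, h1]
      · rintro (k | k) hw hne
        · exact hs _ (by simpa using hne)
        · simp only [deleteEdges_adj, lw_lr] at hw
          rcases hw.1 with rfl | h
          · exact hr'
          · rw [← eq_sub_iff_add_eq] at h
            rwa [h]
    · have hji : i + 1 ≠ j := Ne.symm hj
      have hr2 : .inr (i + 1) ∈ T := by
        refine hT (.inr i) _ hr ?_ ?_
        · simp [deleteEdges_adj, h1]
        · rintro (k | k) hw hne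
          · simp only [deleteEdges_adj, lw_rl] at hw
            rcases hw.1 with rfl | rfl
            · exact hs _ hij
            · exact hs _ hji
          · simp only [deleteEdges_adj, lw_rr] at hw
            rcases hw.1.2 with rfl | h
            · exact absurd rfl hne
            · rw [← sub_eq_iff_eq_add] at h
              rwa [← h]
      refine hT (.inl (i + 1)) _ (hs _ hji) ?_ ?_
      · simp [deleteEdges_adj, hji, h1]
      · rintro (k | k) hw hne
        · exact hs _ (by simpa using hne)
        · simp only [deleteEdges_adj, lw_lr] at hw
          rcases hw.1 with rfl | h
          · exact hr2
          · rw [add_left_inj] at h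
            rwa [h]
  refine fin_down hT (fun k => ?_) i hr ?_
  · by_cases h : k = j
    · rwa [h]
    · exact hs k h
  · simp

lemma upper [NeZero n] (hn : 3 ≤ n) (a b : ZMod n ⊕ ZMod n) (hab : (lw n).Adj a b) :
    ∃ S : Set (ZMod n ⊕ ZMod n), S.ncard = n ∧
      IsZeroForcingSet ((lw n).deleteEdges {s(a, b)}) S := by
  rcases a with i | i <;> rcases b with j | j
  · exact ⟨_, spokes'_card _ _, upper_ll hn i j hab⟩
  · rcases hab with rfl | rfl
    · exact ⟨_, spokes_card, upper_lr_same hn _⟩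
    · exact ⟨_, spokes_card, upper_lr_prev hn _⟩
  · rw [Sym2.eq_swap]
    rcases hab with rfl | rfl
    · exact ⟨_, spokes_card, upper_lr_same hn _⟩
    · exact ⟨_, spokes_card, upper_lr_prev hn _⟩
  · rcases hab.2 with rfl | rfl
    · exact ⟨_, spokes'_card _ _, upper_rr hn _⟩
    · rw [Sym2.eq_swap]
      exact ⟨_, spokes'_card _ _, upper_rr hn _⟩

lemma lw_num [NeZero n] (hn : 3 ≤ n) (a b : ZMod n ⊕ ZMod n) (hab : (lw n).Adj a b) :
    zeroForcingNum ((lw n).deleteEdges {s(a, b)}) = n := by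
  refine le_antisymm (Nat.sInf_le (upper hn a b hab)) ?_
  refine le_csInf ⟨n, upper hn a b hab⟩ ?_
  rintro k ⟨S, rfl, hz⟩
  exact lower hn a b S hz

/-- `ZMod n` as `Fin n`. -/
def zf (n : ℕ) [NeZero n] : ZMod n ≃ Fin n where
  toFun i := ⟨i.val, ZMod.val_lt i⟩
  invFun k := ((k : ℕ) : ZMod n)
  left_inv i := ZMod.natCast_zmod_val i
  right_inv k := Fin.ext (ZMod.val_cast_of_lt k.2)

lemma wheel_none [NeZero n] (k : Fin n) : (wheelGraph n).Adj none (some k) := by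
  simp [wheelGraph]

lemma wheel_some [NeZero n] (hn : 3 ≤ n) (i j : ZMod n) :
    (wheelGraph n).Adj (some (zf n i)) (some (zf n j)) ↔ j = i + 1 ∨ i = j + 1 := by
  obtain ⟨h1, h2⟩ := zmod_facts hn
  have hc : ∀ i : ZMod n, (((zf n i : Fin n) : ℕ) : ZMod n) = i := (zf n).left_inv
  simp only [wheelGraph, fromRel_adj, hc, ne_eq, Option.some.injEq, EmbeddingLike.apply_eq_iff_eq]
  constructor
  · rintro ⟨_, h | h⟩
    · exact Or.inl h.symm
    · exact Or.inr h.symm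
  · rintro (rfl | rfl)
    · exact ⟨by simpa using h1, Or.inl rfl⟩
    · exact ⟨by simpa using h1, Or.inr rfl⟩

def edgeMap (n : ℕ) [NeZero n] (hn : 3 ≤ n) : ZMod n ⊕ ZMod n → (wheelGraph n).edgeSet
  | .inl i => ⟨s(none, some (zf n i)), wheel_none _⟩
  | .inr i => ⟨s(some (zf n i), some (zf n (i + 1))), (wheel_some hn _ _).2 (Or.inl rfl)⟩

lemma edgeMap_bij [NeZero n] (hn : 3 ≤ n) : Function.Bijective (edgeMap n hn) := by
  obtain ⟨h1, h2⟩ := zmod_facts hn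
  constructor
  · rintro (i | i) (j | j) h <;> replace h := congrArg Subtype.val h <;> simp only [edgeMap, Subtype.mk.injEq, Sym2.eq_iff, Option.some.injEq,
      EmbeddingLike.apply_eq_iff_eq, reduceCtorEq, true_and, and_true, false_and, and_false,
      or_false, or_self, Sum.inl.injEq, Sum.inr.injEq] at h ⊢
    · exact h
    · rcases h with h | h
      · exact h.1
      · exact absurd (show (2 : ZMod n) = 0 by linear_combination h.2 - h.1) h2
  · rintro ⟨e, he⟩
    induction e using Sym2.ind with
    | _ u v =>
      rcases u with _ | u <;> rcases v with _ | v
      · exact absurd he (by simp)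
      · obtain ⟨v, rfl⟩ := (zf n).surjective v
        exact ⟨.inl v, rfl⟩
      · obtain ⟨u, rfl⟩ := (zf n).surjective u
        exact ⟨.inl u, Subtype.ext Sym2.eq_swap⟩
      · obtain ⟨u, rfl⟩ := (zf n).surjective u
        obtain ⟨v, rfl⟩ := (zf n).surjective v
        rcases (wheel_some hn u v).1 he with rfl | rfl
        · exact ⟨.inr _, rfl⟩
        · exact ⟨.inr _, Subtype.ext Sym2.eq_swap⟩

lemma edgeMap_adj [NeZero n] (hn : 3 ≤ n) (a b : ZMod n ⊕ ZMod n) :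
    (wheelGraph n).lineGraph.Adj (edgeMap n hn a) (edgeMap n hn b) ↔ (lw n).Adj a b := by
  obtain ⟨h1, h2⟩ := zmod_facts hn
  rw [lineGraph_adj_iff_exists, (edgeMap_bij hn).1.ne_iff]
  rcases a with i | i <;> rcases b with j | j
  · simp [edgeMap]
  · simp only [edgeMap, lw_lr, Sym2.mem_iff]
    simp
    grind
  · simp only [edgeMap, lw_rl, Sym2.mem_iff]
    simp
  · simp only [edgeMap, lw_rr, Sym2.mem_iff]
    simp
    grind

/-- The model is isomorphic to the line graph of the wheel. -/
noncomputable def modelIso (n : ℕ) [NeZero n] (hn : 3 ≤ n) (a b : ZMod n ⊕ ZMod n) :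
    (lw n).deleteEdges {s(a, b)} ≃g
    (wheelGraph n).lineGraph.deleteEdges {s(edgeMap n hn a, edgeMap n hn b)} where
  toEquiv := Equiv.ofBijective _ (edgeMap_bij hn)
  map_rel_iff' := by
    intro u v
    simp only [Equiv.ofBijective_apply, deleteEdges_adj, edgeMap_adj, Set.mem_singleton_iff,
      Sym2.eq_iff, (edgeMap_bij hn).1.eq_iff]

end Model


/-- For `n ≥ 3` and `G = L(W_{1,n})`, deleting any edge `e` of `G` yields a graph
with zero forcing number `n`. -/
theorem zeroForcingNum_lineGraph_wheelGraph_deleteEdge (n : ℕ) (hn : 3 ≤ n)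
    (e : Sym2 ((wheelGraph n).edgeSet))
    (he : e ∈ (wheelGraph n).lineGraph.edgeSet) :
    zeroForcingNum ((wheelGraph n).lineGraph.deleteEdges {e}) = n := by
  haveI : NeZero n := ⟨by omega⟩
  induction e using Sym2.ind with
  | _ u v =>
    obtain ⟨a, rfl⟩ := (edgeMap_bij hn).2 u
    obtain ⟨b, rfl⟩ := (edgeMap_bij hn).2 v
    rw [mem_edgeSet, edgeMap_adj] at he
    rw [← zfNum_iso (modelIso n hn a b)]
    exact lw_num hn a b he
end
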